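/- Let d_K be even with angles θ_1,…,θ_{d_K/2} ∈ ℝ, let φ: ℝ^{d_K} → ℝ^{d_K}, let q, k_1,…,k_i, k'_1,…,k'_M ∈ ℝ^{d_K}, v_1,…,v_i ∈ ℝ^{d_V}, v'_1,…,v'_M ∈ ℝ^{d_V}, and let b ∈ ℝ^{d_K×d_V}. Then for all M, i ≥ 1: (R_{Θ,M+i} φ(q))^T [ Σ_{j=1}^{i} R_{Θ,M+j} φ(k_j) v_j^T + Σ_{j=1}^{M} R_{Θ,j} φ(k'_j) v'^T_j + b ] = (R_{Θ,i} φ(q))^T [ Σ_{j=1}^{i} R_{Θ,j} φ(k_j) v_j^T + Σ_{j=1}^{M} R_{Θ,j−M} φ(k'_j) v'^T_j + R_{Θ,−M} b ]. (Numerator identity in the proof of the main conversion theorem.) -/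

import Mathlib

open Matrix

/-- The rotary (RoPE) matrix `R_{Θ,m} ∈ ℝ^{d×d}` for even `d = 2*h`, angles
`θ : Fin h → ℝ` and shift `m : ℤ`: block-diagonal with `t`-th 2×2 block
`[[cos(mθ_t), −sin(mθ_t)], [sin(mθ_t), cos(mθ_t)]]`. -/
noncomputable def rotary (h : ℕ) (θ : Fin h → ℝ) (m : ℤ) :
    Matrix (Fin (2 * h)) (Fin (2 * h)) ℝ :=
  Matrix.of fun i j =>
    if i.val / 2 = j.val / 2 then
      if i.val % 2 = 0 then
        if j.val % 2 = 0 then Real.cos ((m : ℝ) * θ ⟨i.val / 2, by have := i.isLt; omega⟩)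
        else -Real.sin ((m : ℝ) * θ ⟨i.val / 2, by have := i.isLt; omega⟩)
      else
        if j.val % 2 = 0 then Real.sin ((m : ℝ) * θ ⟨i.val / 2, by have := i.isLt; omega⟩)
        else Real.cos ((m : ℝ) * θ ⟨i.val / 2, by have := i.isLt; omega⟩)
    else 0

theorem transpose_rotary (h : ℕ) (θ : Fin h → ℝ) (m : ℤ) :
    (rotary h θ m)ᵀ = rotary h θ (-m) := by
  ext a b
  simp only [rotary, Matrix.transpose_apply, Matrix.of_apply]
  by_cases hab : a.val / 2 = b.val / 2
  · rcases Nat.mod_two_eq_zero_or_one a.val with ha | ha <;>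
      rcases Nat.mod_two_eq_zero_or_one b.val with hb | hb <;>
      simp [hab, ha, hb]
  · simp [hab, Ne.symm hab]

theorem rotary_mul_rotary (h : ℕ) (θ : Fin h → ℝ) (m n : ℤ) :
    rotary h θ m * rotary h θ n = rotary h θ (m + n) := by
  ext a b
  have ha := a.isLt
  have he : 2 * (a.val / 2) < 2 * h := by omega
  have ho : 2 * (a.val / 2) + 1 < 2 * h := by omega
  rw [Matrix.mul_apply,
    Fintype.sum_eq_add (⟨2 * (a.val / 2), he⟩ : Fin (2 * h)) ⟨2 * (a.val / 2) + 1, ho⟩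
      (by simp)]
  · have hdiv : (2 * (a.val / 2) + 1) / 2 = a.val / 2 := by omega
    have hmod : (2 * (a.val / 2) + 1) % 2 = 1 := by omega
    by_cases hab : a.val / 2 = b.val / 2
    · rcases Nat.mod_two_eq_zero_or_one a.val with ha' | ha' <;>
        rcases Nat.mod_two_eq_zero_or_one b.val with hb' | hb' <;>
        simp [rotary, ha', hb', hdiv, hmod, ← hab, add_mul, Real.cos_add, Real.sin_add] <;>
        ring
    · simp [rotary, hdiv, hab]
  · rintro x ⟨hx₀, hx₁⟩
    have hax : a.val / 2 ≠ x.val / 2 := by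
      simp only [ne_eq, Fin.ext_iff] at hx₀ hx₁
      omega
    simp [rotary, hax]

/-- **Numerator identity in the proof of the main conversion theorem**: for all
`M, i ≥ 1`,
`(R_{Θ,M+i} φ(q))ᵀ [Σ_{j=1}^{i} R_{Θ,M+j} φ(k_j) v_jᵀ + Σ_{j=1}^{M} R_{Θ,j} φ(k'_j) v'_jᵀ + b]
 = (R_{Θ,i} φ(q))ᵀ [Σ_{j=1}^{i} R_{Θ,j} φ(k_j) v_jᵀ + Σ_{j=1}^{M} R_{Θ,j−M} φ(k'_j) v'_jᵀ + R_{Θ,−M} b]`. -/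
theorem numerator_identity {h dV : ℕ} (θ : Fin h → ℝ)
    (φ : (Fin (2 * h) → ℝ) → (Fin (2 * h) → ℝ))
    (M i : ℕ) (hM : 1 ≤ M) (hi : 1 ≤ i)
    (q : Fin (2 * h) → ℝ)
    (k : Fin i → Fin (2 * h) → ℝ) (k' : Fin M → Fin (2 * h) → ℝ)
    (v : Fin i → Fin dV → ℝ) (v' : Fin M → Fin dV → ℝ)
    (b : Matrix (Fin (2 * h)) (Fin dV) ℝ) :
    Matrix.vecMul ((rotary h θ ((M : ℤ) + i)).mulVec (φ q))
      ((∑ j : Fin i,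
          Matrix.vecMulVec ((rotary h θ ((M : ℤ) + (j.val + 1))).mulVec (φ (k j))) (v j))
        + (∑ j : Fin M,
            Matrix.vecMulVec ((rotary h θ (j.val + 1)).mulVec (φ (k' j))) (v' j))
        + b)
      = Matrix.vecMul ((rotary h θ (i : ℤ)).mulVec (φ q))
          ((∑ j : Fin i,
              Matrix.vecMulVec ((rotary h θ (j.val + 1)).mulVec (φ (k j))) (v j))
            + (∑ j : Fin M,
                Matrix.vecMulVec
                  ((rotary h θ ((j.val + 1 : ℤ) - M)).mulVec (φ (k' j))) (v' j))
            + rotary h θ (-(M : ℤ)) * b) := by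
  have hq : (rotary h θ ((M : ℤ) + i)).mulVec (φ q)
      = Matrix.vecMul ((rotary h θ (i : ℤ)).mulVec (φ q)) (rotary h θ (-(M : ℤ))) := by
    rw [← transpose_rotary, Matrix.vecMul_transpose, Matrix.mulVec_mulVec, rotary_mul_rotary]
  rw [hq, Matrix.vecMul_vecMul]
  simp only [Matrix.mul_add, Matrix.mul_sum, Matrix.mul_vecMulVec, Matrix.mulVec_mulVec,
    rotary_mul_rotary, neg_add_eq_sub, add_sub_cancel_left]
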